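/- arXiv:1406.2226 — 2 statements merged into one kernel-verified Lean document; each statement's English description precedes it below -/
import Mathlib

section
/- Let λ be a nondegenerate symmetric bilinear integral form on a finitely generated free abelian group H with characteristic element α ∈ H* (λ(x,x) ≡ α(x) mod 2), and let q = q_{λ,α} be the induced quadratic refinement on T = coker(λ̂) with Arf invariant A(q). Then -A(q) = (λ⁻¹(α,α) - σ(λ))/8 in ℚ/ℤ, where σ(λ) is the signature of λ. -/
open Matrix

/-- The exponential character `r ↦ e^{2πir}` on `ℚ`. -/
noncomputable def eQ : ℚ → ℂ := fun r => Complex.exp (2 * Real.pi * Complex.I * (r : ℂ))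

theorem eQ_periodic : Function.Periodic eQ 1 := by
  intro r
  simp only [eQ]
  push_cast
  rw [mul_add, mul_one, Complex.exp_add, Complex.exp_two_pi_mul_I, mul_one]

/-- The induced character `e^{2πi ·} : ℚ/ℤ → ℂ`. -/
noncomputable def eQZ : AddCircle (1 : ℚ) → ℂ := eQ_periodic.lift

/-- A `ℤ`-vector viewed as a `ℚ`-vector. -/
def ratVec {m : ℕ} (v : Fin m → ℤ) : Fin m → ℚ := fun i => (v i : ℚ)

/-- The rational inverse form `λ⁻¹(x,y) = x ⬝ A⁻¹ y` of an integral form `A`. -/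
noncomputable def linv {m : ℕ} (A : Matrix (Fin m) (Fin m) ℤ) (x y : Fin m → ℚ) : ℚ :=
  x ⬝ᵥ (A.map ((↑) : ℤ → ℚ))⁻¹.mulVec y

open Filter Topology
lemma cosK_tendsto (a : UnitAddCircle) : Tendsto (HurwitzZeta.cosKernel a) atTop (𝓝 1) := by
  obtain ⟨p, hp, h⟩ := HurwitzZeta.isBigO_atTop_cosKernel_sub a
  have h2 : Tendsto (fun x : ℝ => Real.exp (-p * x)) atTop (𝓝 0) := by
    apply Real.tendsto_exp_atBot.comp
    exact tendsto_id.const_mul_atTop_of_neg (by linarith)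
  have := (h.trans_tendsto h2).add_const 1
  simpa using this

lemma theta_tendsto (c : ℝ) : Tendsto (fun s : ℝ => jacobiTheta (Complex.I * s - c)) atTop (𝓝 1) := by
  have h : Tendsto (fun s : ℝ => (Complex.I * s - c : ℂ)) atTop (comap Complex.im atTop) := by
    rw [tendsto_comap_iff]
    simpa [Function.comp_def] using! tendsto_id
  have h2 : Tendsto (fun x : ℝ => Real.exp (-Real.pi * x)) atTop (𝓝 0) := by
    apply Real.tendsto_exp_atBot.comp
    exact tendsto_id.const_mul_atTop_of_neg (by linarith [Real.pi_pos])
  have h3 := (isBigO_at_im_infty_jacobiTheta_sub_one.trans_tendsto (h2.comp tendsto_comap)).comp h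
  have := h3.add_const 1
  simpa [Function.comp_def] using this

open Complex in
lemma theta_split (N : ℕ) [NeZero N] (s : ℝ) (hs : 0 < s) (hN : Even N) :
    jacobiTheta (1 / N + I / (N ^ 2 * s)) =
      ∑ r : Fin N, cexp (Real.pi * I * (r : ℂ) ^ 2 / N) *
        (HurwitzZeta.evenKernel (((r : ℕ) / N : ℝ) : UnitAddCircle) (1 / s) : ℝ) := by
  have hN0 : (N : ℂ) ≠ 0 := NeZero.ne _
  have hN0r : (N : ℝ) ≠ 0 := NeZero.ne _
  have hsc : (s : ℂ) ≠ 0 := by exact_mod_cast hs.ne'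
  have him : 0 < (1 / N + I / (N ^ 2 * s) : ℂ).im := by
    have : (1 / N + I / (N ^ 2 * s) : ℂ) = ((1 / N : ℝ) : ℂ) + ((1 / (N ^ 2 * s) : ℝ) : ℂ) * I := by
      push_cast; ring
    rw [this]
    simp only [add_im, ofReal_im, mul_im, ofReal_re, I_im, I_re]
    have : (0:ℝ) < N := by positivity
    simp
    positivity
  set τ : ℂ := 1 / N + I / (N ^ 2 * s) with hτ
  have hsum : Summable (fun n : ℤ => cexp (Real.pi * I * (n : ℂ) ^ 2 * τ)) := by
    have := (summable_jacobiTheta₂_term_iff 0 τ).2 him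
    refine this.congr fun n => ?_
    simp [jacobiTheta₂_term]
  have hsum2 := (Int.divModEquiv N).symm.summable_iff.2 hsum
  rw [jacobiTheta, ← (Int.divModEquiv N).symm.tsum_eq, ← (Equiv.prodComm (Fin N) ℤ).tsum_eq]
  have hsum3 := (Equiv.prodComm (Fin N) ℤ).summable_iff.2 hsum2
  rw [Summable.tsum_prod (by exact hsum3), tsum_fintype]
  refine Finset.sum_congr rfl fun r _ => ?_
  have h := HurwitzZeta.hasSum_int_evenKernel ((r : ℕ) / N : ℝ) (one_div_pos.2 hs)
  have h' := (hasSum_ofReal.2 h).mul_left (cexp (Real.pi * I * (r : ℂ) ^ 2 / N))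
  rw [← h'.tsum_eq]
  refine tsum_congr fun n => ?_
  obtain ⟨M, hM⟩ := hN
  rw [ofReal_exp, ← Complex.exp_add, Complex.exp_eq_exp_iff_exists_int]
  refine ⟨n * r + n ^ 2 * M, ?_⟩
  simp [Int.divModEquiv, hτ]
  have hM2 : (M:ℂ) = N / 2 := by rw [hM]; push_cast; ring
  rw [hM2]
  field_simp
  ring_nf
  rw [I_sq]
  ring

open Complex in
lemma theta_fe (τ : ℂ) : jacobiTheta τ = 1 / (-I * τ) ^ (1 / 2 : ℂ) * jacobiTheta (-1 / τ) := by
  have := jacobiTheta₂_functional_equation 0 τ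
  simpa [jacobiTheta_eq_jacobiTheta₂] using this

lemma theta_period (M : ℕ) (τ : ℂ) : jacobiTheta (τ - 2 * M) = jacobiTheta τ := by
  induction M with
  | zero => simp
  | succ k ih =>
    rw [← ih, ← jacobiTheta_two_add]
    congr 1
    push_cast
    ring

open Complex in
lemma pos_mul_cpow {r : ℝ} (hr : 0 < r) {z w : ℂ} (hz : z ≠ 0) :
    ((r : ℂ) * z) ^ w = (r : ℂ) ^ w * z ^ w := by
  have hrc : (r : ℂ) ≠ 0 := by exact_mod_cast hr.ne'
  rw [cpow_def_of_ne_zero (mul_ne_zero hrc hz), cpow_def_of_ne_zero hrc, cpow_def_of_ne_zero hz,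
    log_ofReal_mul hr hz, ← Complex.exp_add, ← Complex.ofReal_log hr.le]
  congr 1
  ring

open Complex in
lemma gauss_aux (N : ℕ) [NeZero N] (hN : Even N) :
    ∑ r : Fin N, cexp (Real.pi * I * (r : ℂ) ^ 2 / N) = 1 / (-I / N) ^ (1 / 2 : ℂ) := by
  have hN0 : (N : ℂ) ≠ 0 := NeZero.ne _
  have hN0r : (N : ℝ) ≠ 0 := NeZero.ne _
  have hslit : (-I / N : ℂ) ∈ slitPlane := by
    right
    have : (-I / N : ℂ) = ((-1 / N : ℝ) : ℂ) * I := by push_cast; ring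
    rw [this]
    simpa using NeZero.ne N
  -- key identity
  have key : ∀ s : ℝ, 0 < s →
      ∑ r : Fin N, cexp (Real.pi * I * (r : ℂ) ^ 2 / N) *
        (HurwitzZeta.cosKernel (((r : ℕ) / N : ℝ) : UnitAddCircle) s : ℝ)
      = 1 / (-I * (1 / N + I / (N ^ 2 * s))) ^ (1 / 2 : ℂ) *
        (1 / (1 / (1 + I / (N * s))) ^ (1 / 2 : ℂ)) * jacobiTheta (I * s - (1 / N : ℝ)) := by
    intro s hs
    have hsc : (s : ℂ) ≠ 0 := by exact_mod_cast hs.ne'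
    have h1 := theta_split N s hs hN
    have hz : (1 + I / (N * s) : ℂ) ≠ 0 := by
      intro h
      have h2 := congrArg Complex.re h
      have : (1 + I / (N * s) : ℂ) = 1 + ((1 / (N * s) : ℝ) : ℂ) * I := by push_cast; ring
      rw [this] at h2
      simp at h2
    have hz' : (N * s + I : ℂ) ≠ 0 := by
      intro h
      apply hz
      field_simp
      simpa using h
    have hz'' : (I * s - 1 / N : ℂ) ≠ 0 := by
      intro h
      apply hz'
      field_simp at h
      have : (N * s + I : ℂ) = -I * (N * s * I - 1) := by ring_nf; rw [I_sq]; ring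
      rw [this]
      rw [show (N * s * I - 1 : ℂ) = I * s * N - 1 by ring, h]
      simp
    obtain ⟨M, hM⟩ := hN
    have hM2 : (N:ℂ) = 2 * M := by rw [hM]; push_cast; ring
    rw [theta_fe] at h1
    have h2 : (-1 / (1 / N + I / (N ^ 2 * s)) : ℂ) = -1 / (I * s - 1 / N) - 2 * M := by
      rw [← hM2]
      have e1 : (1 / N + I / (N ^ 2 * s) : ℂ) = (N * s + I) / (N ^ 2 * s) := by
        field_simp
      have e2 : (I * s - 1 / N : ℂ) = I * (N * s + I) / N := by
        field_simp; ring_nf; rw [I_sq]; ring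
      rw [e1, e2]
      field_simp
      ring_nf
      rw [I_sq]
      ring
    rw [h2, theta_period, theta_fe (-1 / (I * s - 1 / N))] at h1
    have h3 : (-1 / (-1 / (I * s - 1 / N)) : ℂ) = I * s - (1 / N : ℝ) := by
      push_cast
      field_simp
    have h4 : (1 / (1 + I / (N * s)) : ℂ) = (s : ℂ) * (-I * (-1 / (I * s - 1 / N))) := by
      have e2 : (I * s - 1 / N : ℂ) = I * (N * s + I) / N := by
        field_simp; ring_nf; rw [I_sq]; ring
      rw [e2]
      field_simp
    have h5 : (1 / (1 + I / (N * s)) : ℂ) ^ (1 / 2 : ℂ) =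
        ((s ^ (1 / 2 : ℝ) : ℝ) : ℂ) * (-I * (-1 / (I * s - 1 / N))) ^ (1 / 2 : ℂ) := by
      rw [h4, pos_mul_cpow hs, Complex.ofReal_cpow hs.le]
      swap
      · exact mul_ne_zero (neg_ne_zero.2 I_ne_zero) (div_ne_zero (by simp) hz'')
      norm_num
    have hs2 : ((s ^ (1 / 2 : ℝ) : ℝ) : ℂ) ≠ 0 := by
      exact_mod_cast (Real.rpow_pos_of_pos hs _).ne'
    rw [h3] at h1
    have h6 : ∀ r : Fin N,
        (HurwitzZeta.evenKernel (((r : ℕ) / N : ℝ) : UnitAddCircle) (1 / s) : ℝ) =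
        s ^ (1 / 2 : ℝ) * HurwitzZeta.cosKernel (((r : ℕ) / N : ℝ) : UnitAddCircle) s := by
      intro r
      rw [HurwitzZeta.evenKernel_functional_equation, one_div_one_div, one_div s,
        Real.inv_rpow hs.le, one_div, inv_inv]
    simp_rw [h6] at h1
    rw [h5]
    have h7 : ∑ r : Fin N, cexp (Real.pi * I * (r : ℂ) ^ 2 / N) *
        ((s ^ (1 / 2 : ℝ) * HurwitzZeta.cosKernel (((r : ℕ) / N : ℝ) : UnitAddCircle) s : ℝ) : ℂ)
        = ((s ^ (1 / 2 : ℝ) : ℝ) : ℂ) * ∑ r : Fin N, cexp (Real.pi * I * (r : ℂ) ^ 2 / N) *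
        (HurwitzZeta.cosKernel (((r : ℕ) / N : ℝ) : UnitAddCircle) s : ℝ) := by
      rw [Finset.mul_sum]
      refine Finset.sum_congr rfl fun r _ => ?_
      rw [ofReal_mul]
      ring
    rw [h7] at h1
    rw [← mul_right_inj' hs2, ← h1]
    rw [one_div (_ * _), mul_inv]
    field_simp
  have hinv : Tendsto (fun s : ℝ => ((s⁻¹ : ℝ) : ℂ)) atTop (𝓝 0) := by
    have := (Complex.continuous_ofReal.tendsto 0).comp tendsto_inv_atTop_zero
    simpa [Function.comp_def] using this
  have hL : Tendsto (fun s : ℝ => ∑ r : Fin N, cexp (Real.pi * I * (r : ℂ) ^ 2 / N) *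
        (HurwitzZeta.cosKernel (((r : ℕ) / N : ℝ) : UnitAddCircle) s : ℝ)) atTop
        (𝓝 (∑ r : Fin N, cexp (Real.pi * I * (r : ℂ) ^ 2 / N) * ((1 : ℝ) : ℂ))) := by
    refine tendsto_finsetSum _ fun r _ => ?_
    exact ((Complex.continuous_ofReal.tendsto 1).comp (cosK_tendsto _)).const_mul _
  have hR1 : Tendsto (fun s : ℝ => (-I * (1 / N + I / (N ^ 2 * s)) : ℂ)) atTop (𝓝 (-I / N)) := by
    have := ((hinv.const_mul (I / N ^ 2)).const_add (1 / N : ℂ)).const_mul (-I)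
    convert this using 2
    · push_cast; ring
    · ring
  have hR2 : Tendsto (fun s : ℝ => (1 / (1 + I / (N * s)) : ℂ)) atTop (𝓝 1) := by
    have := ((hinv.const_mul (I / N)).const_add (1 : ℂ)).inv₀ (by simp)
    convert this using 2
    · push_cast; ring
    · simp
  have hc1 : ContinuousAt (fun z : ℂ => z ^ (1 / 2 : ℂ)) (-I / N) :=
    continuousAt_id.cpow continuousAt_const hslit
  have hc2 : ContinuousAt (fun z : ℂ => z ^ (1 / 2 : ℂ)) 1 :=
    continuousAt_id.cpow continuousAt_const (by simp)
  have hne : (-I / N : ℂ) ^ (1 / 2 : ℂ) ≠ 0 := by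
    rw [Ne, cpow_eq_zero_iff, not_and_or]
    left
    exact div_ne_zero (neg_ne_zero.2 I_ne_zero) hN0
  have hR := (((hc1.tendsto.comp hR1).inv₀ hne).mul
    ((hc2.tendsto.comp hR2).inv₀ (by simp))).mul (theta_tendsto (1 / N))
  have hfin := tendsto_nhds_unique (hL.congr' ?_) hR
  · simpa using hfin
  · filter_upwards [eventually_gt_atTop 0] with s hs
    rw [key s hs]
    simp

open Complex in
lemma gauss_pos (N : ℕ) [NeZero N] (hN : Even N) : ∃ c : ℝ, 0 < c ∧
    ∑ r : Fin N, cexp (Real.pi * I * (r : ℂ) ^ 2 / N) = c * cexp (Real.pi * I / 4) := by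
  have hNp : (0:ℝ) < (N : ℝ)⁻¹ := by have := NeZero.pos N; positivity
  refine ⟨((N : ℝ)⁻¹ ^ (1 / 2 : ℝ))⁻¹, by positivity, ?_⟩
  rw [gauss_aux N hN]
  have h4 : (-I / N : ℂ) = ((N : ℝ)⁻¹ : ℝ) * (-I) := by push_cast; ring
  rw [h4, pos_mul_cpow hNp (neg_ne_zero.2 I_ne_zero), ofReal_inv (_ ^ _),
    Complex.ofReal_cpow hNp.le]
  have h5 : (-I) ^ (1 / 2 : ℂ) = cexp (-(Real.pi * I / 4)) := by
    rw [cpow_def_of_ne_zero (neg_ne_zero.2 I_ne_zero), log_neg_I]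
    congr 1
    ring
  rw [h5, Complex.exp_neg]
  push_cast
  rw [one_div, mul_inv, inv_inv]
open Filter Topology
lemma eQ_add (a b : ℚ) : eQ (a + b) = eQ a * eQ b := by
  simp only [eQ]
  rw [← Complex.exp_add]
  congr 1
  push_cast
  ring

lemma eQ_int (n : ℤ) : eQ n = 1 := by
  simp only [eQ]
  rw [Complex.exp_eq_one_iff]
  exact ⟨n, by push_cast; ring⟩

lemma eQ_eq_one {r : ℚ} (h : eQ r = 1) : ∃ n : ℤ, r = n := by
  simp only [eQ] at h
  rw [Complex.exp_eq_one_iff] at h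
  obtain ⟨n, hn⟩ := h
  refine ⟨n, ?_⟩
  have h2 : (2 * Real.pi * Complex.I : ℂ) ≠ 0 := Complex.two_pi_I_ne_zero
  rw [mul_comm (n : ℂ)] at hn
  have := mul_left_cancel₀ h2 hn
  exact_mod_cast this

lemma eQ_ne_zero (r : ℚ) : eQ r ≠ 0 := Complex.exp_ne_zero _

lemma eQ_sum {ι : Type*} (s : Finset ι) (f : ι → ℚ) : eQ (∑ i ∈ s, f i) = ∏ i ∈ s, eQ (f i) := by
  classical
  induction s using Finset.induction_on with
  | empty => simpa using eQ_int 0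
  | insert i s hi ih => rw [Finset.sum_insert hi, Finset.prod_insert hi, eQ_add, ih]

lemma eQ_neg (r : ℚ) : eQ (-r) = (starRingEnd ℂ) (eQ r) := by
  simp only [eQ]
  rw [← Complex.exp_conj]
  congr 1
  simp only [map_mul, Complex.conj_ofReal, Complex.conj_I, map_ratCast, Complex.conj_ofNat]
  push_cast
  ring

lemma norm_eQ (r : ℚ) : ‖eQ r‖ = 1 := by
  have : (2 * Real.pi * Complex.I * (r : ℂ) : ℂ) = ((2 * Real.pi * r : ℝ) : ℂ) * Complex.I := by
    push_cast; ring
  simp only [eQ]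
  rw [this, Complex.norm_exp_ofReal_mul_I]

lemma eQZ_coe (r : ℚ) : eQZ (r : AddCircle (1 : ℚ)) = eQ r := rfl

lemma sum_zmod (N : ℕ) [NeZero N] (F : ZMod N → ℂ) :
    ∑ x : ZMod N, F x = ∑ r : Fin N, F (((r : ℕ) : ℤ) : ZMod N) := by
  cases N with
  | zero => exact absurd rfl (NeZero.ne 0)
  | succ k =>
    refine Finset.sum_congr rfl fun x _ => ?_
    congr 1
    rw [Int.cast_natCast]
    exact (ZMod.natCast_zmod_val (n := k + 1) x).symm

lemma gauss_d (a b : ℤ) (ha : a ≠ 0) [NeZero (4 * a).natAbs] (g : ZMod (4 * a).natAbs → ℂ)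
    (hg : ∀ n : ℤ, g n = eQ (((n : ℚ) ^ 2 + n * (2 * b)) / (4 * a) / 2)) :
    ∃ c : ℝ, 0 < c ∧ ∑ x, g x = c * eQ (((SignType.sign a : ℤ) - (2 * b : ℚ) ^ 2 / (4 * a)) / 8) := by
  have haq : (a : ℚ) ≠ 0 := by exact_mod_cast ha
  obtain ⟨c, hc, hG⟩ := gauss_pos (4 * a).natAbs (by
    rw [Int.natAbs_mul]; exact ⟨2 * a.natAbs, by simp; ring⟩)
  have h1 : ∑ x, g x = eQ (-((2 * b : ℚ) ^ 2 / (4 * a)) / 8) *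
      ∑ r : Fin (4 * a).natAbs, eQ (((r : ℕ) : ℚ) ^ 2 / (8 * a)) := by
    rw [← (Equiv.subRight (b : ZMod (4 * a).natAbs)).sum_comp, sum_zmod, Finset.mul_sum]
    refine Finset.sum_congr rfl fun r _ => ?_
    rw [Equiv.subRight_apply, ← Int.cast_sub, hg, ← eQ_add]
    congr 1
    push_cast
    field_simp
    ring
  have h2 : ∑ r : Fin (4 * a).natAbs, eQ (((r : ℕ) : ℚ) ^ 2 / (8 * a)) =
      c * eQ ((SignType.sign a : ℤ) / 8) := by
    rcases lt_or_gt_of_ne ha with h | h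
    · have hN : (((4 * a).natAbs : ℕ) : ℂ) = -(4 * a : ℂ) := by
        have : (((4 * a).natAbs : ℕ) : ℤ) = -(4 * a) := by omega
        have h3 := congrArg (Int.cast : ℤ → ℂ) this
        rw [Int.cast_natCast] at h3
        rw [h3]
        push_cast
        ring
      have e1 : ∀ r : Fin (4 * a).natAbs, eQ (((r : ℕ) : ℚ) ^ 2 / (8 * a)) =
          (starRingEnd ℂ) (Complex.exp (Real.pi * Complex.I * (r : ℂ) ^ 2 / (4 * a).natAbs)) := by
        intro r
        rw [← neg_neg (((r : ℕ) : ℚ) ^ 2 / (8 * a)), eQ_neg, hN]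
        congr 1
        simp only [eQ]
        congr 1
        push_cast
        have : (a : ℂ) ≠ 0 := by exact_mod_cast ha
        field_simp
        ring
      simp_rw [e1]
      rw [← map_sum, hG, sign_neg h]
      rw [map_mul, Complex.conj_ofReal]
      congr 1
      have : ((((-1 : SignType)) : ℤ) : ℚ) / 8 = - (1 / 8) := by norm_num
      rw [this, eQ_neg]
      congr 1
      simp only [eQ]
      congr 1
      push_cast
      ring
    · have hN : (((4 * a).natAbs : ℕ) : ℂ) = (4 * a : ℂ) := by
        have : (((4 * a).natAbs : ℕ) : ℤ) = (4 * a) := by omega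
        have h3 := congrArg (Int.cast : ℤ → ℂ) this
        rw [Int.cast_natCast] at h3
        rw [h3]
        push_cast
        ring
      have e1 : ∀ r : Fin (4 * a).natAbs, eQ (((r : ℕ) : ℚ) ^ 2 / (8 * a)) =
          (Complex.exp (Real.pi * Complex.I * (r : ℂ) ^ 2 / (4 * a).natAbs)) := by
        intro r
        rw [hN]
        simp only [eQ]
        congr 1
        push_cast
        have : (a : ℂ) ≠ 0 := by exact_mod_cast ha
        field_simp
        ring
      simp_rw [e1]
      rw [hG, sign_pos h]
      congr 1
      rw [SignType.coe_one]
      simp only [eQ]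
      congr 1
      push_cast
      ring
  refine ⟨c, hc, ?_⟩
  rw [h1, h2, mul_left_comm, ← eQ_add]
  congr 2
  ring

lemma sum_comp_surj {K T : Type*} [AddCommGroup K] [Fintype K] [AddCommGroup T] [Fintype T]
    (p : K →+ T) (hp : Function.Surjective p) (g : T → ℂ) :
    ∃ c : ℝ, 0 < c ∧ ∑ k, g (p k) = c * ∑ t, g t := by
  classical
  refine ⟨(Finset.univ.filter fun k => p k = 0).card, ?_, ?_⟩
  · have : 0 < (Finset.univ.filter fun k => p k = 0).card :=
      Finset.card_pos.2 ⟨0, by simp⟩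
    exact_mod_cast this
  · rw [← Finset.sum_fiberwise (s := Finset.univ) (g := p), Finset.mul_sum]
    refine Finset.sum_congr rfl fun t _ => ?_
    rw [AddMonoidHom.card_fiber_eq_of_mem_range p ⟨0, map_zero p⟩ (hp t)]
    rw [Finset.sum_congr rfl (g := fun _ => g t)]
    · simp
    · intro k hk
      rw [(Finset.mem_filter.1 hk).2]

lemma sum_prop {V T₁ T₂ : Type*} [AddCommGroup V] [AddCommGroup T₁] [Fintype T₁]
    [AddCommGroup T₂] [Fintype T₂] (j₁ : V →+ T₁) (j₂ : V →+ T₂)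
    (h₁ : Function.Surjective j₁) (h₂ : Function.Surjective j₂) (g₁ : T₁ → ℂ) (g₂ : T₂ → ℂ)
    (h : ∀ v, g₁ (j₁ v) = g₂ (j₂ v)) :
    ∃ c : ℝ, 0 < c ∧ ∑ t, g₁ t = c * ∑ t, g₂ t := by
  classical
  let K := (j₁.prod j₂).range
  have : Fintype K := Fintype.ofFinite K
  let p₁ : K →+ T₁ := (AddMonoidHom.fst T₁ T₂).comp K.subtype
  let p₂ : K →+ T₂ := (AddMonoidHom.snd T₁ T₂).comp K.subtype
  have s₁ : Function.Surjective p₁ := fun t => by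
    obtain ⟨v, rfl⟩ := h₁ t
    exact ⟨⟨(j₁ v, j₂ v), v, rfl⟩, rfl⟩
  have s₂ : Function.Surjective p₂ := fun t => by
    obtain ⟨v, rfl⟩ := h₂ t
    exact ⟨⟨(j₁ v, j₂ v), v, rfl⟩, rfl⟩
  obtain ⟨c₁, hc₁, e₁⟩ := sum_comp_surj p₁ s₁ g₁
  obtain ⟨c₂, hc₂, e₂⟩ := sum_comp_surj p₂ s₂ g₂
  have e : ∑ k, g₁ (p₁ k) = ∑ k, g₂ (p₂ k) := by
    refine Finset.sum_congr rfl fun k _ => ?_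
    obtain ⟨_, v, rfl⟩ := k
    exact h v
  refine ⟨c₁⁻¹ * c₂, by positivity, ?_⟩
  have : (c₁ : ℂ) ≠ 0 := by exact_mod_cast hc₁.ne'
  rw [e₁, e₂] at e
  push_cast
  rw [mul_assoc, ← e]
  field_simp

lemma sum_isotropic {V T : Type*} [AddCommGroup V] [AddCommGroup T] [Fintype T]
    (g : T → ℂ) (K : AddSubgroup T) [Fintype K] (l : V →+ T) (hl : ∀ x, l x ∈ K)
    (h : ∀ t, t ∉ K → ∃ x : V, ∃ c : ℂ, c ≠ 1 ∧ ∀ y, g (t + l y + l x) = c * g (t + l y)) :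
    ∑ t, g t = ∑ t : K, g t := by
  classical
  let L := l.range
  have : Fintype L := Fintype.ofFinite L
  let F : T → ℂ := fun t => if t ∈ K then 0 else g t
  have hLK : ∀ y : L, (y : T) ∈ K := by
    rintro ⟨_, x, rfl⟩
    exact hl x
  have hin : ∀ t, ∑ y : L, F (t + y) = 0 := by
    intro t
    by_cases ht : t ∈ K
    · refine Finset.sum_eq_zero fun y _ => ?_
      exact if_pos (K.add_mem ht (hLK y))
    · obtain ⟨x, c, hc, hx⟩ := h t ht
      have hF : ∀ y : L, F (t + y) = g (t + y) := fun y =>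
        if_neg fun hh => ht ((K.add_mem_cancel_right (hLK y)).1 hh)
      simp_rw [hF]
      have e : ∑ y : L, g (t + y) = c * ∑ y : L, g (t + y) := by
        conv_lhs => rw [← Equiv.sum_comp (Equiv.addRight (⟨l x, x, rfl⟩ : L))]
        rw [Finset.mul_sum]
        refine Finset.sum_congr rfl fun y _ => ?_
        obtain ⟨_, y, rfl⟩ := y
        rw [← hx y]
        simp [add_assoc]
      have e2 : (1 - c) * ∑ y : L, g (t + y) = 0 := by rw [sub_mul, ← e]; ring
      exact (mul_eq_zero.1 e2).resolve_left (sub_ne_zero.2 hc.symm)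
  have hF0 : ∑ t, F t = 0 := by
    have e1 : ∑ y : L, ∑ t, F (t + y) = 0 := by
      rw [Finset.sum_comm]
      exact Finset.sum_eq_zero fun t _ => hin t
    have e2 : ∀ y : L, ∑ t, F (t + y) = ∑ t, F t := fun y => Equiv.sum_comp (Equiv.addRight (y : T)) F
    simp_rw [e2] at e1
    simpa using e1
  have : ∑ t, g t = ∑ t, F t + ∑ t, (if t ∈ K then g t else 0) := by
    rw [← Finset.sum_add_distrib]
    refine Finset.sum_congr rfl fun t _ => ?_
    by_cases ht : t ∈ K <;> simp [F, ht]
  rw [this, hF0, zero_add, ← Finset.sum_filter]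
  exact (Finset.sum_subtype _ (by simp) _)
open Filter Topology Matrix
lemma exists_diag {m : ℕ} (A : Matrix (Fin m) (Fin m) ℤ) (hsymm : A.IsSymm) (hdet : A.det ≠ 0) :
    ∃ (B : Matrix (Fin m) (Fin m) ℤ) (a : Fin m → ℤ), B.det ≠ 0 ∧ (∀ i, a i ≠ 0) ∧
      Bᵀ * A * B = Matrix.diagonal a := by
  classical
  let Aq : Matrix (Fin m) (Fin m) ℚ := A.map ((↑) : ℤ → ℚ)
  have hs : (Matrix.toBilin' Aq).IsSymm := by
    rw [Matrix.isSymm_toBilin'_iff_isSymm]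
    exact hsymm.map _
  obtain ⟨v0, hv0⟩ := LinearMap.BilinForm.exists_orthogonal_basis (LinearMap.BilinForm.isSymm_iff.1 hs)
  let v := v0.reindex (finCongr (by simp : Module.finrank ℚ (Fin m → ℚ) = m))
  have hv : ∀ i j, i ≠ j → v i ⬝ᵥ Aq *ᵥ v j = 0 := by
    intro i j hij
    have := hv0 (i := (finCongr (by simp : Module.finrank ℚ (Fin m → ℚ) = m)).symm i)
      (j := (finCongr (by simp : Module.finrank ℚ (Fin m → ℚ) = m)).symm j) (by simpa using hij)
    simpa [Matrix.toBilin'_apply', v, Function.onFun] using this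
  obtain ⟨n, hn⟩ := IsLocalization.exist_integer_multiples_of_finite (nonZeroDivisors ℤ)
    (fun p : Fin m × Fin m => v p.1 p.2)
  choose w hw using hn
  have hn0 : ((n : ℤ) : ℚ) ≠ 0 := by exact_mod_cast nonZeroDivisors.coe_ne_zero n
  have hw' : ∀ i j, ((w (i, j) : ℤ) : ℚ) = (n : ℤ) * v i j := by
    intro i j
    have := hw (i, j)
    simpa [Algebra.smul_def] using this
  let B : Matrix (Fin m) (Fin m) ℤ := Matrix.of fun j i => w (i, j)
  have hB : B.map ((↑) : ℤ → ℚ) = ((n : ℤ) : ℚ) • (Pi.basisFun ℚ (Fin m)).toMatrix v := by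
    ext j i
    simp [B, hw', Module.Basis.toMatrix_apply]
  have hBdet : B.det ≠ 0 := by
    intro h
    have h1 : (B.map ((↑) : ℤ → ℚ)).det = 0 := by
      have := Int.cast_det (R := ℚ) B
      rw [h] at this
      simpa using this.symm
    rw [hB, Matrix.det_smul] at h1
    have h2 : ((Pi.basisFun ℚ (Fin m)).toMatrix v).det ≠ 0 := by
      have := Module.Basis.invertibleToMatrix (Pi.basisFun ℚ (Fin m)) v
      exact (Matrix.isUnit_det_of_invertible _).ne_zero
    exact mul_ne_zero (pow_ne_zero _ hn0) h2 h1
  have hdiag : Bᵀ * A * B = Matrix.diagonal fun i => (Bᵀ * A * B) i i := by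
    ext i j
    by_cases hij : i = j
    · subst hij; simp
    · rw [Matrix.diagonal_apply_ne _ hij]
      have h1 : (((Bᵀ * A * B) i j : ℤ) : ℚ) = ((n : ℤ) : ℚ) ^ 2 * (v i ⬝ᵥ Aq *ᵥ v j) := by
        rw [Matrix.mul_assoc]
        simp only [Matrix.mul_apply, Matrix.transpose_apply, dotProduct, Matrix.mulVec,
          Finset.mul_sum, B, Matrix.of_apply]
        push_cast
        refine Finset.sum_congr rfl fun k _ => Finset.sum_congr rfl fun l _ => ?_
        rw [hw', hw']
        simp only [Aq, Matrix.map_apply]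
        ring
      rw [hv i j hij, mul_zero] at h1
      exact_mod_cast h1
  refine ⟨B, fun i => (Bᵀ * A * B) i i, hBdet, ?_, hdiag⟩
  have h2 := congrArg Matrix.det hdiag
  rw [Matrix.det_mul, Matrix.det_mul, Matrix.det_transpose, Matrix.det_diagonal] at h2
  have h3 : B.det * A.det * B.det ≠ 0 := mul_ne_zero (mul_ne_zero hBdet hdet) hBdet
  rw [h2, Finset.prod_ne_zero_iff] at h3
  exact fun i => h3 i (Finset.mem_univ i)

lemma sig_aux {m : ℕ} (A P : Matrix (Fin m) (Fin m) ℝ) (d : Fin m → ℝ) (hP : IsUnit P.det)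
    (h : P * A * P.transpose = Matrix.diagonal d) :
    sigPos (Matrix.toBilin' A).toQuadraticMap = (Finset.univ.filter fun i => 0 < d i).card ∧
    sigNeg (Matrix.toBilin' A).toQuadraticMap = (Finset.univ.filter fun i => d i < 0).card := by
  have hPt : IsUnit Pᵀ.det := by rwa [Matrix.det_transpose]
  have e : QuadraticMap.Equivalent (QuadraticMap.weightedSumSquares ℝ d)
      (Matrix.toBilin' A).toQuadraticMap := by
    refine ⟨⟨Matrix.toLinearEquiv' Pᵀ (Matrix.invertibleOfIsUnitDet _ hPt), fun x => ?_⟩⟩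
    have h1 : (Pᵀ *ᵥ x) ⬝ᵥ A *ᵥ (Pᵀ *ᵥ x) = x ⬝ᵥ (P * A * Pᵀ) *ᵥ x := by
      rw [← Matrix.mulVec_mulVec, ← Matrix.mulVec_mulVec, Matrix.dotProduct_mulVec x P,
        Matrix.mulVec_transpose]
    rw [h] at h1
    simp only [LinearMap.BilinMap.toQuadraticMap_apply, Matrix.toBilin'_apply',
      QuadraticMap.weightedSumSquares_apply, smul_eq_mul]
    refine h1.trans ?_
    simp only [dotProduct, Matrix.mulVec_diagonal]
    exact Finset.sum_congr rfl fun i _ => by ring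
  rw [QuadraticForm.sigPos_of_equiv_weightedSumSquares e.symm,
    QuadraticForm.sigNeg_of_equiv_weightedSumSquares e.symm]
  constructor <;> rw [← Set.ncard_coe_finset] <;> simp


lemma sig_eq {m : ℕ} (A B : Matrix (Fin m) (Fin m) ℤ) (a : Fin m → ℤ) (hB : B.det ≠ 0)
    (hBA : Bᵀ * A * B = Matrix.diagonal a) (sig : ℤ)
    (hsig : ∃ (P : Matrix (Fin m) (Fin m) ℝ) (d : Fin m → ℝ), IsUnit P.det ∧
        P * (A.map ((↑) : ℤ → ℝ)) * P.transpose = Matrix.diagonal d ∧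
        sig = ((Finset.univ.filter fun i => 0 < d i).card : ℤ) -
            ((Finset.univ.filter fun i => d i < 0).card : ℤ)) :
    sig = ∑ i, (SignType.sign (a i) : ℤ) := by
  obtain ⟨P, d, hP, hPA, rfl⟩ := hsig
  obtain ⟨h1, h2⟩ := sig_aux _ P d hP hPA
  have hBr : IsUnit ((B.map ((↑) : ℤ → ℝ))ᵀ).det := by
    rw [Matrix.det_transpose, isUnit_iff_ne_zero]
    have := Int.cast_det (R := ℝ) B
    rw [← this]
    exact_mod_cast hB
  have hBAr : (B.map ((↑) : ℤ → ℝ))ᵀ * (A.map ((↑) : ℤ → ℝ)) * ((B.map ((↑) : ℤ → ℝ))ᵀ)ᵀ =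
      Matrix.diagonal (fun i => (a i : ℝ)) := by
    have := congrArg (fun M : Matrix (Fin m) (Fin m) ℤ => M.map (Int.castRingHom ℝ)) hBA
    simp only [Matrix.map_mul, Matrix.diagonal_map (map_zero _), Matrix.transpose_map] at this
    rw [Matrix.transpose_transpose]
    exact this
  obtain ⟨h3, h4⟩ := sig_aux _ _ _ hBr hBAr
  rw [← h1, ← h2, h3, h4, Finset.card_filter, Finset.card_filter]
  push_cast
  rw [← Finset.sum_sub_distrib]
  refine Finset.sum_congr rfl fun i _ => ?_
  simp only [Int.cast_pos, Int.cast_lt_zero]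
  rcases lt_trichotomy (a i) 0 with h | h | h
  · rw [sign_neg h]; simp [h, h.le]
  · simp [h]
  · rw [sign_pos h]; simp [h, h.le]

lemma ratVec_mulVec {m : ℕ} (M : Matrix (Fin m) (Fin m) ℤ) (x : Fin m → ℤ) :
    ratVec (M *ᵥ x) = (M.map ((↑) : ℤ → ℚ)) *ᵥ ratVec x := by
  ext i
  simp [ratVec, Matrix.mulVec, dotProduct]

lemma ratVec_add {m : ℕ} (x y : Fin m → ℤ) : ratVec (x + y) = ratVec x + ratVec y := by
  ext i
  simp [ratVec]

lemma ratVec_dot {m : ℕ} (x y : Fin m → ℤ) :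
    ratVec x ⬝ᵥ ratVec y = ((x ⬝ᵥ y : ℤ) : ℚ) := by
  simp [ratVec, dotProduct]

lemma mulVec_dot {m : ℕ} (M : Matrix (Fin m) (Fin m) ℚ) (u w : Fin m → ℚ) :
    (M *ᵥ u) ⬝ᵥ w = u ⬝ᵥ Mᵀ *ᵥ w := by
  rw [Matrix.dotProduct_mulVec, Matrix.vecMul_transpose]

section
variable {m : ℕ} (A B D : Matrix (Fin m) (Fin m) ℚ)

lemma rat_inv (h : D * (Bᵀ * A * B) = 1) : (B * D * Bᵀ) * A = 1 := by
  have h1 : (D * Bᵀ * A) * B = 1 := by rw [← h]; simp only [Matrix.mul_assoc]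
  have h2 := mul_eq_one_comm.1 h1
  rw [← h2]
  simp only [Matrix.mul_assoc]

lemma rat_form (h : D * (Bᵀ * A * B) = 1) (x y : Fin m → ℚ) :
    x ⬝ᵥ A⁻¹ *ᵥ y = (Bᵀ *ᵥ x) ⬝ᵥ D *ᵥ (Bᵀ *ᵥ y) := by
  rw [Matrix.inv_eq_left_inv (rat_inv A B D h), mulVec_dot, Matrix.transpose_transpose]
  simp only [Matrix.mulVec_mulVec, Matrix.mul_assoc]

lemma rat_shift (hA : Aᵀ = A) (hD : Dᵀ = D) (h : D * (Bᵀ * A * B) = 1) (φ x α : Fin m → ℚ) :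
    ((φ + (Bᵀ * A) *ᵥ x) ⬝ᵥ D *ᵥ (φ + (Bᵀ * A) *ᵥ x) +
      (φ + (Bᵀ * A) *ᵥ x) ⬝ᵥ D *ᵥ (Bᵀ *ᵥ α)) / 2 =
    (φ ⬝ᵥ D *ᵥ φ + φ ⬝ᵥ D *ᵥ (Bᵀ *ᵥ α)) / 2 + φ ⬝ᵥ (D * Bᵀ * A) *ᵥ x +
      (x ⬝ᵥ A *ᵥ x + x ⬝ᵥ α) / 2 := by
  have hinv := rat_inv A B D h
  have hinv2 := mul_eq_one_comm.1 hinv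
  have e1 : ((Bᵀ * A) *ᵥ x) ⬝ᵥ D *ᵥ φ = φ ⬝ᵥ (D * Bᵀ * A) *ᵥ x := by
    rw [dotProduct_comm, mulVec_dot, hD, Matrix.mulVec_mulVec, Matrix.mul_assoc]
  have e2 : φ ⬝ᵥ D *ᵥ ((Bᵀ * A) *ᵥ x) = φ ⬝ᵥ (D * Bᵀ * A) *ᵥ x := by
    rw [Matrix.mulVec_mulVec, Matrix.mul_assoc]
  have e3 : ((Bᵀ * A) *ᵥ x) ⬝ᵥ D *ᵥ ((Bᵀ * A) *ᵥ x) = x ⬝ᵥ A *ᵥ x := by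
    rw [mulVec_dot, Matrix.transpose_mul, Matrix.transpose_transpose, hA, Matrix.mulVec_mulVec,
      Matrix.mulVec_mulVec]
    have : A * B * D * (Bᵀ * A) = A := by
      calc A * B * D * (Bᵀ * A) = A * (B * D * Bᵀ * A) := by simp only [Matrix.mul_assoc]
        _ = A := by rw [hinv, Matrix.mul_one]
    rw [this]
  have e4 : ((Bᵀ * A) *ᵥ x) ⬝ᵥ D *ᵥ (Bᵀ *ᵥ α) = x ⬝ᵥ α := by
    rw [mulVec_dot, Matrix.transpose_mul, Matrix.transpose_transpose, hA, Matrix.mulVec_mulVec,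
      Matrix.mulVec_mulVec]
    have : A * B * D * Bᵀ = 1 := by
      rw [← hinv2]; simp only [Matrix.mul_assoc]
    rw [this, Matrix.one_mulVec]
  rw [Matrix.mulVec_add, add_dotProduct, add_dotProduct, dotProduct_add, dotProduct_add, e1, e2,
    e3, e4]
  ring

lemma rat_pair (hA : Aᵀ = A) (h : D * (Bᵀ * A * B) = 1) (x y : Fin m → ℚ) :
    ((Bᵀ * A) *ᵥ y) ⬝ᵥ (D * Bᵀ * A) *ᵥ x = y ⬝ᵥ A *ᵥ x := by
  have hinv := rat_inv A B D h
  rw [mulVec_dot, Matrix.transpose_mul, Matrix.transpose_transpose, hA, Matrix.mulVec_mulVec]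
  have : A * B * (D * Bᵀ * A) = A := by
    calc A * B * (D * Bᵀ * A) = A * (B * D * Bᵀ * A) := by simp only [Matrix.mul_assoc]
      _ = A := by rw [hinv, Matrix.mul_one]
  rw [this]
end
open Filter Topology Matrix

lemma gpart (a b : ℤ) (ha : a ≠ 0) [NeZero (4 * a).natAbs] : ∃ g : ZMod (4 * a).natAbs → ℂ,
    ∀ n : ℤ, g n = eQ (((n : ℚ) ^ 2 + n * (2 * b)) / (4 * a) / 2) := by
  have haq : (a : ℚ) ≠ 0 := by exact_mod_cast ha
  refine ⟨fun x => eQ ((((x.cast : ℤ) : ℚ) ^ 2 + (x.cast : ℤ) * (2 * b)) / (4 * a) / 2), fun n => ?_⟩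
  beta_reduce
  have h1 : (((n : ZMod (4 * a).natAbs).cast : ℤ) : ZMod (4 * a).natAbs) = (n : ZMod _) := by simp
  rw [ZMod.intCast_eq_intCast_iff_dvd_sub] at h1
  have h2 : 4 * a ∣ n - ((n : ZMod (4 * a).natAbs).cast : ℤ) := Int.natAbs_dvd.1 h1
  obtain ⟨k, hk⟩ := h2
  generalize ((n : ZMod (4 * a).natAbs).cast : ℤ) = x at h1 hk ⊢
  have hn : n = x + 4 * a * k := by linarith
  subst hn
  rw [← mul_one (eQ (((x : ℚ) ^ 2 + x * (2 * b)) / (4 * a) / 2)),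
    ← eQ_int (x * k + 2 * a * k ^ 2 + b * k), ← eQ_add]
  congr 1
  push_cast
  field_simp
  ring

lemma gauss_main {m : ℕ}
    (A : Matrix (Fin m) (Fin m) ℤ) (hsymm : A.IsSymm)
    (α : Fin m → ℤ)
    (hchar : ∀ x : Fin m → ℤ, ∃ c : ℤ, x ⬝ᵥ A.mulVec x = α ⬝ᵥ x + 2 * c)
    (B₀ : Matrix (Fin m) (Fin m) ℤ) (a : Fin m → ℤ) (ha : ∀ i, a i ≠ 0)
    (hBA : B₀ᵀ * A * B₀ = Matrix.diagonal a)
    {T : Type*} [AddCommGroup T] [Fintype T]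
    (j : (Fin m → ℤ) →+ T) (hjsurj : Function.Surjective j) (g : T → ℂ)
    (hg : ∀ φ : Fin m → ℤ, g (j φ) =
      eQ ((linv A (ratVec φ) (ratVec φ) + linv A (ratVec φ) (ratVec α)) / 2)) :
    ∃ c : ℝ, 0 < c ∧ ∑ t, g t = c * eQ (((∑ i, (SignType.sign (a i) : ℤ) : ℤ) -
      linv A (ratVec α) (ratVec α)) / 8) := by
  classical
  have inst : ∀ i, NeZero (4 * a i).natAbs := fun i => ⟨by have := ha i; omega⟩
  let b : Fin m → ℤ := B₀ᵀ *ᵥ α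
  let B : Matrix (Fin m) (Fin m) ℤ := (2 : ℤ) • B₀
  let Aq : Matrix (Fin m) (Fin m) ℚ := A.map ((↑) : ℤ → ℚ)
  let Bq : Matrix (Fin m) (Fin m) ℚ := B.map ((↑) : ℤ → ℚ)
  let D : Matrix (Fin m) (Fin m) ℚ := Matrix.diagonal fun i => (4 * a i : ℚ)⁻¹
  have hA : Aqᵀ = Aq := (hsymm.map _).eq
  have hD : Dᵀ = D := Matrix.diagonal_transpose _
  have hβ : Bqᵀ *ᵥ ratVec α = fun i => (2 * b i : ℚ) := by
    have h1 : Bqᵀ *ᵥ ratVec α = ratVec (Bᵀ *ᵥ α) := by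
      rw [ratVec_mulVec, Matrix.transpose_map]
    have h2 : Bᵀ *ᵥ α = (2 : ℤ) • b := by
      simp only [B, b]
      rw [Matrix.transpose_smul, Matrix.smul_mulVec]
    rw [h1, h2]
    ext i
    simp only [ratVec, Pi.smul_apply, smul_eq_mul]
    push_cast
    rfl
  have hDB : D * (Bqᵀ * Aq * Bq) = 1 := by
    have h1 : Bᵀ * A * B = Matrix.diagonal fun i => 4 * a i := by
      have : Bᵀ * A * B = (4 : ℤ) • (B₀ᵀ * A * B₀) := by
        simp only [B, Matrix.transpose_smul, Matrix.smul_mul, Matrix.mul_smul, smul_smul]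
        norm_num
      rw [this, hBA]
      ext i k
      by_cases h : i = k
      · subst h; simp
      · simp [h]
    have h2 := congrArg (fun M : Matrix (Fin m) (Fin m) ℤ => M.map (Int.castRingHom ℚ)) h1
    simp only [Matrix.map_mul, Matrix.diagonal_map (map_zero _), Matrix.transpose_map] at h2
    have h3 : Bqᵀ * Aq * Bq = Matrix.diagonal fun i => (4 * a i : ℚ) := by
      refine Eq.trans h2 ?_
      congr 1
      ext i
      simp
    rw [h3, Matrix.diagonal_mul_diagonal, ← Matrix.diagonal_one]
    congr 1
    ext i
    have : (a i : ℚ) ≠ 0 := by exact_mod_cast ha i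
    field_simp
  choose gi hgi using fun i => gpart (a i) (b i) (ha i)
  let T' := ∀ i, ZMod (4 * a i).natAbs
  let j' : (Fin m → ℤ) →+ T' :=
    { toFun := fun φ i => (φ i : ZMod _)
      map_zero' := funext fun i => Int.cast_zero
      map_add' := fun x y => funext fun i => Int.cast_add _ _ }
  have hj' : Function.Surjective j' := by
    intro t
    refine ⟨fun i => ((t i).cast : ℤ), ?_⟩
    ext i
    simp [j']
  let g' : T' → ℂ := fun t => ∏ i, gi i (t i)
  have hg' : ∀ φ, g' (j' φ) = eQ ((ratVec φ ⬝ᵥ D *ᵥ ratVec φ +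
      ratVec φ ⬝ᵥ D *ᵥ (Bqᵀ *ᵥ ratVec α)) / 2) := by
    intro φ
    have h1 : g' (j' φ) = ∏ i, gi i (φ i : ZMod _) := rfl
    rw [h1]
    simp_rw [hgi]
    rw [← eQ_sum, hβ]
    congr 1
    simp only [dotProduct, D, Matrix.mulVec_diagonal, ratVec]
    rw [← Finset.sum_add_distrib, Finset.sum_div]
    refine Finset.sum_congr rfl fun i _ => ?_
    have : (a i : ℚ) ≠ 0 := by exact_mod_cast ha i
    field_simp
  let bt : (Fin m → ℤ) →+ (Fin m → ℤ) := (Matrix.mulVecLin Bᵀ).toAddMonoidHom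
  let bta : (Fin m → ℤ) →+ (Fin m → ℤ) := (Matrix.mulVecLin (Bᵀ * A)).toAddMonoidHom
  have hbt : ∀ x, ratVec (bt x) = Bqᵀ *ᵥ ratVec x := by
    intro x
    have : bt x = Bᵀ *ᵥ x := rfl
    rw [this, ratVec_mulVec, Matrix.transpose_map]
  have hbta : ∀ x, ratVec (bta x) = (Bqᵀ * Aq) *ᵥ ratVec x := by
    intro x
    have : bta x = Bᵀ *ᵥ (A *ᵥ x) := by rw [Matrix.mulVec_mulVec]; rfl
    rw [this, ratVec_mulVec, ratVec_mulVec, Matrix.mulVec_mulVec, Matrix.transpose_map]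
  let K := (j'.comp bt).range
  have : Fintype K := Fintype.ofFinite K
  have hshift : ∀ φ x, g' (j' (φ + bta x)) =
      eQ (ratVec φ ⬝ᵥ (D * Bqᵀ * Aq) *ᵥ ratVec x) * g' (j' φ) := by
    intro φ x
    rw [hg', hg', ratVec_add, hbta, rat_shift Aq Bq D hA hD hDB, eQ_add, eQ_add]
    have : eQ ((ratVec x ⬝ᵥ Aq *ᵥ ratVec x + ratVec x ⬝ᵥ ratVec α) / 2) = 1 := by
      obtain ⟨c, hc⟩ := hchar x
      rw [← ratVec_mulVec, ratVec_dot, ratVec_dot, hc, dotProduct_comm x α]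
      rw [← eQ_int (α ⬝ᵥ x + c)]
      congr 1
      push_cast
      ring
    rw [this]
    ring
  have hiso : ∑ t, g' t = ∑ t : K, g' t := by
    refine sum_isotropic g' K (j'.comp bta) ?_ ?_
    · intro x
      refine ⟨A *ᵥ x, ?_⟩
      change j' (Bᵀ *ᵥ (A *ᵥ x)) = j' ((Bᵀ * A) *ᵥ x)
      rw [Matrix.mulVec_mulVec]
    · intro t ht
      obtain ⟨φ, rfl⟩ := hj' t
      have hx : ∃ x, eQ (ratVec φ ⬝ᵥ (D * Bqᵀ * Aq) *ᵥ ratVec x) ≠ 1 := by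
        by_contra hcon
        push Not at hcon
        apply ht
        have hzint : ∀ i, ∃ n : ℤ, ((D * Bqᵀ * Aq)ᵀ *ᵥ ratVec φ) i = n := by
          intro i
          obtain ⟨n, hn⟩ := eQ_eq_one (hcon (Pi.single i 1))
          refine ⟨n, ?_⟩
          rw [← hn, Matrix.dotProduct_mulVec, ← Matrix.mulVec_transpose]
          have : ratVec (Pi.single i 1 : Fin m → ℤ) = Pi.single i 1 := by
            ext k
            by_cases h : k = i
            · subst h; simp [ratVec]
            · simp [ratVec, h]
          rw [this, dotProduct_single, mul_one]
        choose ψ hψ using hzint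
        have hψ' : (D * Bqᵀ * Aq)ᵀ *ᵥ ratVec φ = ratVec ψ := funext hψ
        refine ⟨ψ, ?_⟩
        change j' (bt ψ) = j' φ
        congr 1
        have h1 : ratVec (bt ψ) = ratVec φ := by
          rw [hbt, ← hψ', Matrix.mulVec_mulVec, ← Matrix.transpose_mul]
          have : D * Bqᵀ * Aq * Bq = 1 := by rw [← hDB]; simp only [Matrix.mul_assoc]
          rw [this, Matrix.transpose_one, Matrix.one_mulVec]
        ext i
        have := congrFun h1 i
        simpa [ratVec] using this
      obtain ⟨x, hx⟩ := hx
      refine ⟨x, _, hx, fun y => ?_⟩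
      have e1 : j' φ + (j'.comp bta) y + (j'.comp bta) x = j' (φ + bta y + bta x) := by
        simp only [map_add, AddMonoidHom.comp_apply]
      have e2 : j' φ + (j'.comp bta) y = j' (φ + bta y) := by
        simp only [map_add, AddMonoidHom.comp_apply]
      rw [e1, e2, hshift, ratVec_add, add_dotProduct, hbta, rat_pair Aq Bq D hA hDB, eQ_add,
        ← ratVec_mulVec, ratVec_dot, eQ_int, mul_one]
  obtain ⟨c₀, hc₀, h₀⟩ := sum_prop j (j'.comp bt).rangeRestrict hjsurj
    (AddMonoidHom.rangeRestrict_surjective _) g (fun t : K => g' t) (by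
      intro v
      change g (j v) = g' (j' (bt v))
      rw [hg, hg', hbt]
      simp only [linv]
      rw [rat_form Aq Bq D hDB, rat_form Aq Bq D hDB])
  choose c hc hcg using fun i => gauss_d (a i) (b i) (ha i) (gi i) (hgi i)
  refine ⟨c₀ * ∏ i, c i, mul_pos hc₀ (Finset.prod_pos fun i _ => hc i), ?_⟩
  rw [h₀, ← hiso, ← Fintype.prod_sum]
  simp_rw [hcg]
  rw [Finset.prod_mul_distrib, ← eQ_sum]
  push_cast
  rw [mul_assoc]
  congr 3
  simp only [linv]
  rw [rat_form Aq Bq D hDB, hβ, ← Finset.sum_div, Finset.sum_sub_distrib]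
  congr 2
  simp only [dotProduct, D, Matrix.mulVec_diagonal]
  refine Finset.sum_congr rfl fun i _ => ?_
  have : (a i : ℚ) ≠ 0 := by exact_mod_cast ha i
  field_simp

/-- for a nondegenerate characteristic form `(λ, α)` with signature `σ(λ)`,
the Arf invariant of the induced quadratic refinement `q_{λ,α}` on `T = coker λ̂`
satisfies `-A(q) = (λ⁻¹(α,α) - σ(λ))/8` in `ℚ/ℤ`. -/
theorem stmt7 {m : ℕ}
    (A : Matrix (Fin m) (Fin m) ℤ) (hsymm : A.IsSymm) (hdet : A.det ≠ 0)
    (α : Fin m → ℤ)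
    (hchar : ∀ x : Fin m → ℤ, ∃ c : ℤ, x ⬝ᵥ A.mulVec x = α ⬝ᵥ x + 2 * c)
    (sig : ℤ)
    (hsig : ∃ (P : Matrix (Fin m) (Fin m) ℝ) (d : Fin m → ℝ), IsUnit P.det ∧
        P * (A.map ((↑) : ℤ → ℝ)) * P.transpose = Matrix.diagonal d ∧
        sig = ((Finset.univ.filter fun i => 0 < d i).card : ℤ) -
            ((Finset.univ.filter fun i => d i < 0).card : ℤ))
    {T : Type*} [AddCommGroup T] [Fintype T]
    (j : (Fin m → ℤ) →+ T) (hjsurj : Function.Surjective j)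
    (hjker : ∀ φ : Fin m → ℤ, j φ = 0 ↔ ∃ x : Fin m → ℤ, φ = A.mulVec x)
    (q : T → AddCircle (1 : ℚ))
    (hq : ∀ φ : Fin m → ℤ, q (j φ) =
        (((linv A (ratVec φ) (ratVec φ) + linv A (ratVec φ) (ratVec α)) / 2 : ℚ) :
          AddCircle (1 : ℚ)))
    (Arf : AddCircle (1 : ℚ))
    (hArf : ∑ x : T, eQZ (q x) = Real.sqrt (Fintype.card T) * eQZ Arf) :
    -Arf = (((linv A (ratVec α) (ratVec α) - (sig : ℚ)) / 8 : ℚ) : AddCircle (1 : ℚ)) := by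
  obtain ⟨B, a, hB, ha, hBA⟩ := exists_diag A hsymm hdet
  have hs := sig_eq A B a hB hBA sig hsig
  obtain ⟨c, hc, hsum⟩ := gauss_main A hsymm α hchar B a ha hBA j hjsurj (fun t => eQZ (q t))
    (fun φ => by rw [hq, eQZ_coe])
  rw [← hs, hArf] at hsum
  obtain ⟨r, rfl⟩ := QuotientAddGroup.mk_surjective Arf
  change _ * eQ r = _ at hsum
  have hT : 0 < Real.sqrt (Fintype.card T) := by
    apply Real.sqrt_pos.2
    exact_mod_cast Fintype.card_pos
  have hn := congrArg norm hsum
  rw [norm_mul, norm_mul, norm_eQ, norm_eQ, Complex.norm_real, Complex.norm_real, mul_one, mul_one,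
    Real.norm_of_nonneg hT.le, Real.norm_of_nonneg hc.le] at hn
  rw [hn] at hsum
  have hcc : (c : ℂ) ≠ 0 := by exact_mod_cast hc.ne'
  have he := mul_left_cancel₀ hcc hsum
  have he2 : eQ (r + (linv A (ratVec α) (ratVec α) - (sig : ℚ)) / 8) = 1 := by
    rw [eQ_add, he, ← eQ_add, ← eQ_int 0]
    congr 1
    push_cast
    ring
  obtain ⟨n, hn⟩ := eQ_eq_one he2
  rw [neg_eq_iff_add_eq_zero]
  change ((r + (linv A (ratVec α) (ratVec α) - (sig : ℚ)) / 8 : ℚ) : AddCircle (1 : ℚ)) = 0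
  rw [hn, AddCircle.coe_eq_zero_iff]
  exact ⟨n, by simp⟩
end

section
/- Let G be a finitely generated abelian group with torsion subgroup T, b a torsion form on T, and p ∈ 2G with F(p) = p required. The map P : Aut_b(G) → ℚ/2d_πℤ defined by P(F) := Δ(k, F(k) - k) = d_π² b(F(k)-k, F(k)-k) - 2 d_π b(p - d_π k, F(k)-k), for any k ∈ S_{d_π}, is well-defined (independent of k) and is a group homomorphism: P(F∘F') = P(F) + P(F'). -/
/-- The "term of automorphy" `Δ(β_k, t) = d_π² b(t,t) - 2 d_π b(β_k, t) ∈ ℚ/2d_πℤ`. -/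
noncomputable def Delta {G : Type*} [AddCommGroup G] (T : AddSubgroup G)
    (b : T → T → AddCircle (1 : ℚ)) (d : ℕ) (hd : (2 * (d : ℚ)) ≠ 0)
    (β t : T) : AddCircle (2 * (d : ℚ)) :=
  (d / 2 : ℕ) • (AddCircle.equivAddCircle (1 : ℚ) (2 * (d : ℚ)) one_ne_zero hd (b t t)) -
    AddCircle.equivAddCircle (1 : ℚ) (2 * (d : ℚ)) one_ne_zero hd (b β t)

theorem Delta_cocycle {G : Type*} [AddCommGroup G] (T : AddSubgroup G)
    (b : T → T → AddCircle (1 : ℚ))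
    (hsymm : ∀ s t, b s t = b t s)
    (hadd : ∀ s t u, b (s + t) u = b s u + b t u)
    (d : ℕ) (heven : Even d) (hd2 : (2 * (d : ℚ)) ≠ 0)
    (β β' s t u : T) (h1 : β = β' + d • s) (h2 : u = s + t) :
    Delta T b d hd2 β u = Delta T b d hd2 β s + Delta T b d hd2 β' t := by
  obtain ⟨m, rfl⟩ := heven
  have hadd' : ∀ s t u, b u (s + t) = b u s + b u t := by
    intro s t u
    rw [hsymm, hadd, hsymm s, hsymm t]
  have hz : ∀ u, b 0 u = 0 := by
    intro u
    have := hadd 0 0 u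
    simpa using this
  have hsm : ∀ (n : ℕ) (s u : T), b (n • s) u = n • b s u := by
    intro n s u
    induction n with
    | zero => simp [hz]
    | succ n ih => rw [succ_nsmul, hadd, ih, succ_nsmul]
  have hm : (m + m) / 2 = m := by omega
  subst h1 h2
  unfold Delta
  rw [hm]
  simp only [hadd, hadd', hsm, map_add, map_nsmul, hsymm t s, smul_add, add_smul]
  abel

/-- the map `P : Aut_b(G) → ℚ/2d_πℤ`, `P(F) := Δ(k, F(k)-k)` for any
`k ∈ S_{d_π}`, is well defined (independent of `k`) and is a group homomorphism:
`P(F ∘ F') = P(F) + P(F')`. -/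
theorem stmt18 {G : Type*} [AddCommGroup G] [AddGroup.FG G]
    (T : AddSubgroup G) (hT : ∀ x : G, x ∈ T ↔ IsOfFinAddOrder x)
    (b : T → T → AddCircle (1 : ℚ))
    (hsymm : ∀ s t, b s t = b t s)
    (hadd : ∀ s t u, b (s + t) u = b s u + b t u)
    (hbinj : ∀ s t : T, (∀ u, b u s = b u t) → s = t)
    (hbsurj : ∀ φ : T →+ AddCircle (1 : ℚ), ∃ s, ∀ u, φ u = b u s)
    (p : G) (hp2 : ∃ g : G, p = 2 • g)
    (d : ℕ) (hd0 : 0 < d) (heven : Even d) (hd2 : (2 * (d : ℚ)) ≠ 0)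
    (hwit : ∃ k : G, p - (d : ℤ) • k ∈ T)
    (hmax : ∀ e : ℕ, (∃ k : G, p - (e : ℤ) • k ∈ T) → e ≤ d)
    (F F' : G ≃+ G) (hFp : F p = p) (hF'p : F' p = p)
    (hFb : ∀ (s t : T) (hs : F (s : G) ∈ T) (ht : F (t : G) ∈ T),
        b ⟨F (s : G), hs⟩ ⟨F (t : G), ht⟩ = b s t)
    (hF'b : ∀ (s t : T) (hs : F' (s : G) ∈ T) (ht : F' (t : G) ∈ T),
        b ⟨F' (s : G), hs⟩ ⟨F' (t : G), ht⟩ = b s t) :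
    -- `P(F)` is independent of the choice of `k ∈ S_{d_π}`
    (∀ (k k' : G) (hk : p - (d : ℤ) • k ∈ T) (hk' : p - (d : ℤ) • k' ∈ T)
        (ht : F k - k ∈ T) (ht' : F k' - k' ∈ T),
        Delta T b d hd2 ⟨p - (d : ℤ) • k, hk⟩ ⟨F k - k, ht⟩ =
          Delta T b d hd2 ⟨p - (d : ℤ) • k', hk'⟩ ⟨F k' - k', ht'⟩) ∧
    -- `P` is a homomorphism: `P(F ∘ F') = P(F) + P(F')`
    (∀ (k : G) (hk : p - (d : ℤ) • k ∈ T)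
        (hc : F (F' k) - k ∈ T) (h1 : F k - k ∈ T) (h2 : F' k - k ∈ T),
        Delta T b d hd2 ⟨p - (d : ℤ) • k, hk⟩ ⟨F (F' k) - k, hc⟩ =
          Delta T b d hd2 ⟨p - (d : ℤ) • k, hk⟩ ⟨F k - k, h1⟩ +
            Delta T b d hd2 ⟨p - (d : ℤ) • k, hk⟩ ⟨F' k - k, h2⟩) := by
  have hFT : ∀ (H : G ≃+ G) (x : G), x ∈ T → H x ∈ T := by
    intro H x hx
    rw [hT] at hx ⊢
    exact H.toAddMonoidHom.isOfFinAddOrder hx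
  have coc : ∀ (k l m : G) (hk : p - (d : ℤ) • k ∈ T) (hl : p - (d : ℤ) • l ∈ T)
      (hkl : l - k ∈ T) (hlm : m - l ∈ T) (hkm : m - k ∈ T),
      Delta T b d hd2 ⟨p - (d : ℤ) • k, hk⟩ ⟨m - k, hkm⟩ =
        Delta T b d hd2 ⟨p - (d : ℤ) • k, hk⟩ ⟨l - k, hkl⟩ +
        Delta T b d hd2 ⟨p - (d : ℤ) • l, hl⟩ ⟨m - l, hlm⟩ := by
    intro k l m hk hl hkl hlm hkm
    apply Delta_cocycle T b hsymm hadd d heven hd2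
    · ext
      simp [smul_sub]
    · ext
      simp
  have inv : ∀ (k l : G) (hk : p - (d : ℤ) • k ∈ T) (hk' : p - (d : ℤ) • F k ∈ T)
      (hkl : l - k ∈ T) (hkl' : F l - F k ∈ T),
      Delta T b d hd2 ⟨p - (d : ℤ) • F k, hk'⟩ ⟨F l - F k, hkl'⟩ =
        Delta T b d hd2 ⟨p - (d : ℤ) • k, hk⟩ ⟨l - k, hkl⟩ := by
    intro k l hk hk' hkl hkl'
    have e1 : (⟨p - (d : ℤ) • F k, hk'⟩ : T) = ⟨F (p - (d : ℤ) • k), hFT F _ hk⟩ := by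
      ext
      simp [hFp]
    have e2 : (⟨F l - F k, hkl'⟩ : T) = ⟨F (l - k), hFT F _ hkl⟩ := by
      ext
      simp
    unfold Delta
    rw [e1, e2, hFb ⟨_, hkl⟩ ⟨_, hkl⟩, hFb ⟨_, hk⟩ ⟨_, hkl⟩]
  have hS : ∀ k, p - (d : ℤ) • k ∈ T → p - (d : ℤ) • F k ∈ T := by
    intro k hk
    have := hFT F _ hk
    simpa [hFp] using this
  refine ⟨?_, ?_⟩
  · intro k k' hk hk' ht ht'
    have hs : k' - k ∈ T := by
      have h : d • (k' - k) ∈ T := by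
        have := T.sub_mem hk hk'
        have e : p - (d : ℤ) • k - (p - (d : ℤ) • k') = d • (k' - k) := by
          simp [smul_sub]
        rwa [e] at this
      rw [hT] at h ⊢
      exact (isOfFinAddOrder_nsmul.1 h).resolve_right hd0.ne'
    have hFs : F k' - F k ∈ T := by simpa using hFT F _ hs
    have hm : F k' - k ∈ T := by simpa using T.add_mem ht' hs
    have a1 := coc k k' (F k') hk hk' hs ht' hm
    have a2 := coc k (F k) (F k') hk (hS k hk) ht hFs hm
    rw [inv k k' hk (hS k hk) hs hFs, a1, add_comm] at a2
    exact (add_right_cancel a2).symm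
  · intro k hk hc h1 h2
    have h3 : F (F' k) - F k ∈ T := by simpa using hFT F _ h2
    rw [coc k (F k) (F (F' k)) hk (hS k hk) h1 h3 hc, inv k (F' k) hk (hS k hk) h2 h3]
end
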